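/- Let r and k be integers with 0 ≤ k ≤ r−1 and n ≥ 2r−k. Then the collection of all r-element subsets of an n-element set can be partitioned into ⌊(1/2)·C(n,r)⌋ pairs of r-subsets, each pair intersecting in exactly k elements, together with one leftover r-subset when C(n,r) is odd. -/

import Mathlib

/-- Involutions that move each vertex to a neighbour or fix it: these encode matchings, the
fixed points being the unmatched vertices. -/
def SimpleGraph.IsMatchingInvolution {V : Type*} (G : SimpleGraph V) (f : V → V) : Prop :=
  Function.Involutive f ∧ ∀ v, f v ≠ v → G.Adj v (f v)

/-- Matching involutions with the fewest fixed points: these encode maximum matchings. -/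
def SimpleGraph.IsMaximumMatchingInvolution {V : Type*} (G : SimpleGraph V) (f : V → V) : Prop :=
  G.IsMatchingInvolution f ∧ ∀ g, G.IsMatchingInvolution g →
    (Function.fixedPoints f).ncard ≤ (Function.fixedPoints g).ncard

/-- If `x` is fixed by `f`, then some set containing `x` and closed under both involutions `f` and
`g` contains at most one fixed point of `g`: the vertex set of the alternating path from `x`. -/
theorem Function.Involutive.exists_invariant_set {V : Type*} {f g : V → V}
    (hf : Function.Involutive f) (hg : Function.Involutive g) {x : V} (hx : f x = x) :
    ∃ O : Set V, x ∈ O ∧ (∀ v, f v ∈ O ↔ v ∈ O) ∧ (∀ v, g v ∈ O ↔ v ∈ O) ∧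
      ∀ u ∈ O, ∀ v ∈ O, g u = u → g v = v → u = v := by
  set F : Equiv.Perm V := hf.toPerm
  set H : Equiv.Perm V := hg.toPerm
  have hFF : F * F = 1 := Equiv.ext fun v => hf v
  have hHH : H * H = 1 := Equiv.ext fun v => hg v
  have hFi : F⁻¹ = F := inv_eq_of_mul_eq_one_left hFF
  have hHi : H⁻¹ = H := inv_eq_of_mul_eq_one_left hHH
  set s : Equiv.Perm V := F * H with hs
  have hFs (i : ℤ) : F * s ^ i = s ^ (-i) * F := by
    have h : F * s * F⁻¹ = s⁻¹ := by
      simp [hs, mul_inv_rev, hFi, hHi, ← mul_assoc, hFF]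
    have := conj_zpow (a := F) (b := s) (i := i)
    rw [h, inv_zpow', eq_mul_inv_iff_mul_eq] at this
    exact this.symm
  have hf_zpow (i : ℤ) : f ((s ^ i) x) = (s ^ (-i)) x := by
    have := congrArg (fun p : Equiv.Perm V => p x) (hFs i)
    have hFx : F x = x := hx
    rw [Equiv.Perm.mul_apply, Equiv.Perm.mul_apply, hFx] at this
    exact this
  have hg_zpow (i : ℤ) : g ((s ^ i) x) = (s ^ (-i - 1)) x := by
    have h1 : H = F * s := by simp [hs, ← mul_assoc, hFF]
    have h2 : H * s ^ i = F * s ^ (i + 1) := by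
      rw [h1, mul_assoc, ← zpow_one_add, add_comm]
    have h3 : g ((s ^ i) x) = f ((s ^ (i + 1)) x) :=
      congrArg (fun p : Equiv.Perm V => p x) h2
    rw [h3, hf_zpow]
    congr 2
    ring
  have closed {h : V → V} (hh : Function.Involutive h)
      (hO : ∀ i : ℤ, ∃ j : ℤ, h ((s ^ i) x) = (s ^ j) x) (v : V) :
      h v ∈ Set.range (fun i : ℤ => (s ^ i) x) ↔ v ∈ Set.range (fun i : ℤ => (s ^ i) x) := by
    have (w : V) (hw : w ∈ Set.range (fun i : ℤ => (s ^ i) x)) :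
        h w ∈ Set.range (fun i : ℤ => (s ^ i) x) := by
      obtain ⟨i, rfl⟩ := hw
      obtain ⟨j, hj⟩ := hO i
      exact ⟨j, hj.symm⟩
    exact ⟨fun hv => hh v ▸ this _ hv, this v⟩
  refine ⟨Set.range fun i : ℤ => (s ^ i) x, ⟨0, rfl⟩, closed hf fun i => ⟨_, hf_zpow i⟩,
    closed hg fun i => ⟨_, hg_zpow i⟩, ?_⟩
  rintro _ ⟨i, rfl⟩ _ ⟨j, rfl⟩ hi hj
  simp only [hg_zpow] at hi hj ⊢
  have key {a b : ℤ} :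
      (s ^ a) x = (s ^ b) x ↔ s ^ (a - b) ∈ MulAction.stabilizer (Equiv.Perm V) x := by
    rw [MulAction.mem_stabilizer_iff, Equiv.Perm.smul_def, sub_eq_neg_add, zpow_add, zpow_neg,
      Equiv.Perm.mul_apply, Equiv.Perm.inv_eq_iff_eq]
  rw [key] at hi hj ⊢
  have h := mul_mem (zpow_mem hi j) (inv_mem (zpow_mem hj i))
  rw [← zpow_mul, ← zpow_mul, ← zpow_neg, ← zpow_add] at h
  convert h using 2
  ring

/-- If a maximum matching misses `u` and `v` and another one misses `x`, then some maximum matching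
misses `x` together with `u` or `v`. -/
theorem SimpleGraph.exists_isMaximumMatchingInvolution_fixed_pair {V : Type*} [Finite V] {G : SimpleGraph V}
    {u v x : V} (huv : u ≠ v) {f g : V → V} (hf : G.IsMaximumMatchingInvolution f)
    (hg : G.IsMaximumMatchingInvolution g) (hx : f x = x) (hu : g u = u) (hv : g v = v) :
    ∃ h, G.IsMaximumMatchingInvolution h ∧ h x = x ∧ (h u = u ∨ h v = v) := by
  classical
  obtain ⟨O, hxO, hfO, hgO, hO⟩ := hf.1.1.exists_invariant_set hg.1.1 hx
  have swap {a b : V → V} (ha : G.IsMatchingInvolution a) (hb : G.IsMatchingInvolution b)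
      (haO : ∀ v, a v ∈ O ↔ v ∈ O) (hbO : ∀ v, b v ∈ O ↔ v ∈ O) :
      G.IsMatchingInvolution (O.piecewise a b) := by
    constructor
    · intro w
      by_cases hw : w ∈ O
      · simp [hw, haO, ha.1 w]
      · simp [hw, hbO, hb.1 w]
    · intro w
      by_cases hw : w ∈ O
      · simpa [hw] using ha.2 w
      · simpa [hw] using hb.2 w
  have hfg := swap hf.1 hg.1 hfO hgO
  have hgf := swap hg.1 hf.1 hgO hfO
  have := Fintype.ofFinite V
  have hcard : (Function.fixedPoints (O.piecewise f g)).ncard +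
      (Function.fixedPoints (O.piecewise g f)).ncard =
      (Function.fixedPoints f).ncard + (Function.fixedPoints g).ncard := by
    simp only [Set.ncard_eq_toFinset_card', Function.fixedPoints, Function.IsFixedPt,
      Set.toFinset_ofPred, Finset.card_filter, ← Finset.sum_add_distrib]
    refine Finset.sum_congr rfl fun w _ => ?_
    by_cases hw : w ∈ O
    · simp [hw]
    · simp [hw, add_comm]
  refine ⟨O.piecewise f g, ⟨hfg, fun a ha => ?_⟩, by simp [hxO, hx], ?_⟩
  · have h1 := hf.2 _ hgf
    have h2 := hg.2 _ ha
    omega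
  · by_cases huO : u ∈ O
    · have hvO : v ∉ O := fun hvO => huv (hO u huO v hvO hu hv)
      exact Or.inr (by simp [hvO, hv])
    · exact Or.inl (by simp [huO, hu])

theorem SimpleGraph.exists_isMaximumMatchingInvolution {V : Type*} (G : SimpleGraph V) :
    ∃ f, G.IsMaximumMatchingInvolution f := by
  obtain ⟨f, hf, hmin⟩ := WellFounded.has_min
    (measure fun f : V → V => (Function.fixedPoints f).ncard).wf {f | G.IsMatchingInvolution f}
    ⟨id, fun _ => rfl, fun _ h => (h rfl).elim⟩
  exact ⟨f, hf, fun g hg => not_lt.1 (hmin g hg)⟩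

theorem SimpleGraph.IsMatchingInvolution.conj {V : Type*} {G : SimpleGraph V} {f : V → V}
    (hf : G.IsMatchingInvolution f) (φ : G ≃g G) :
    G.IsMatchingInvolution (φ ∘ f ∘ φ.symm) := by
  refine ⟨fun v => by simp [hf.1 _], fun v hv => ?_⟩
  have := hf.2 (φ.symm v) fun h => hv (by simp [h])
  simpa using φ.map_adj_iff.2 this

theorem SimpleGraph.IsMaximumMatchingInvolution.conj {V : Type*} {G : SimpleGraph V}
    {f : V → V} (hf : G.IsMaximumMatchingInvolution f) (φ : G ≃g G) :
    G.IsMaximumMatchingInvolution (φ ∘ f ∘ φ.symm) := by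
  refine ⟨hf.1.conj φ, fun g hg => ?_⟩
  have : Function.fixedPoints (φ ∘ f ∘ φ.symm) = φ '' Function.fixedPoints f := by
    ext v
    constructor
    · intro hv
      exact ⟨φ.symm v, by simpa [Function.IsFixedPt] using congrArg φ.symm hv, by simp⟩
    · rintro ⟨w, hw, rfl⟩
      simp [Function.IsFixedPt, hw.eq]
  rw [this, Set.ncard_image_of_injective _ φ.injective]
  exact hf.2 g hg

/-- A connected vertex-transitive finite graph has a matching missing at most one vertex. -/
theorem SimpleGraph.exists_isMatchingInvolution_subsingleton {V : Type*} [Finite V]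
    (G : SimpleGraph V) (hG : G.Preconnected) (htrans : ∀ u v, ∃ φ : G ≃g G, φ u = v) :
    ∃ f, G.IsMatchingInvolution f ∧ (Function.fixedPoints f).Subsingleton := by
  classical
  obtain ⟨f, hf⟩ := G.exists_isMaximumMatchingInvolution
  refine ⟨f, hf.1, ?_⟩
  intro u hu v hv
  by_contra huv
  have fixes (x : V) : ∃ g, G.IsMaximumMatchingInvolution g ∧ g x = x := by
    obtain ⟨φ, rfl⟩ := htrans u x
    exact ⟨_, hf.conj φ, by simp [hu.eq]⟩
  have main (a b : V) (h : G.Reachable a b) : ∀ g, G.IsMaximumMatchingInvolution g →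
      g a = a → g b = b → a = b := by
    obtain ⟨p⟩ := h
    induction p with
    | nil => intros; rfl
    | @cons a c b hac p ih =>
      intro g hg ha hb
      by_contra hab
      have adj (h : V → V) (hh : G.IsMaximumMatchingInvolution h) (hc : h c = c) : h a ≠ a := by
        intro ha
        have hne : a ≠ c := hac.ne
        let k : V → V := fun v => if v = a then c else if v = c then a else h v
        have hk_ne (v : V) (hva : v ≠ a) (hvc : v ≠ c) : h v ≠ a ∧ h v ≠ c :=
          ⟨fun e => hva (by rw [← hh.1.1 v, e, ha]), fun e => hvc (by rw [← hh.1.1 v, e, hc])⟩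
        have hk : G.IsMatchingInvolution k := by
          constructor
          · intro v
            by_cases hva : v = a
            · simp [k, hva, hne.symm]
            by_cases hvc : v = c
            · simp [k, hvc, hne.symm]
            simp [k, hva, hvc, hk_ne v hva hvc, hh.1.1 v]
          · intro v
            by_cases hva : v = a
            · simp [k, hva, hac]
            by_cases hvc : v = c
            · simp [k, hvc, hne.symm, hac.symm]
            simpa [k, hva, hvc] using hh.1.2 v
        refine (hh.2 k hk).not_gt (Set.ncard_lt_ncard ⟨fun v hv => ?_, fun hsub => ?_⟩
          (Set.toFinite _))
        · have hv : k v = v := hv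
          by_cases hva : v = a
          · exact hva ▸ ha
          by_cases hvc : v = c
          · exact hvc ▸ hc
          simpa [k, hva, hvc, Function.IsFixedPt] using hv
        · have : k a = a := hsub ha
          exact hne (by simpa [k] using this.symm)
      obtain ⟨h', hh', hc'⟩ := fixes c
      obtain ⟨h, hh, hc, ha' | hb'⟩ := SimpleGraph.exists_isMaximumMatchingInvolution_fixed_pair
        hab hh' hg hc' ha hb
      · exact adj h hh hc ha'
      · have := ih h hh hc hb'
        subst this
        exact adj g hg hb ha
  exact huv (main u v (hG u v) f hf hu hv)

/-- The generalized Johnson graph: `r`-subsets of `α`, adjacent when they share exactly `k`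
elements. -/
def Set.powersetCard.interGraph (α : Type*) [DecidableEq α] (r k : ℕ) :
    SimpleGraph (Set.powersetCard α r) where
  Adj e f := e ≠ f ∧ (e.1 ∩ f.1).card = k
  symm := ⟨fun e f h => ⟨h.1.symm, by rw [Finset.inter_comm]; exact h.2⟩⟩
  loopless := ⟨fun _ h => h.1 rfl⟩

open scoped Pointwise in
theorem Set.powersetCard.interGraph_exists_iso (α : Type*) [DecidableEq α] (r k : ℕ)
    (e f : Set.powersetCard α r) :
    ∃ φ : Set.powersetCard.interGraph α r k ≃g Set.powersetCard.interGraph α r k, φ e = f := by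
  obtain ⟨g, rfl⟩ := (Set.powersetCard.isPretransitive (α := α) (n := r)).exists_smul_eq e f
  refine ⟨⟨MulAction.toPerm g, ?_⟩, rfl⟩
  intro a b
  simp only [Set.powersetCard.interGraph, MulAction.toPerm_apply, ne_eq, smul_left_cancel_iff]
  rw [Set.powersetCard.coe_smul, Set.powersetCard.coe_smul, ← Finset.smul_finset_inter,
    Finset.card_smul_finset]

/-- Two `r`-sets obtained from a common `(r - 1)`-set `s` have a common neighbour. -/
theorem Set.powersetCard.exists_card_insert_inter_eq {α : Type*} [DecidableEq α] [Fintype α]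
    {r k : ℕ} (hk : k < r) (hn : 2 * r - k ≤ Fintype.card α)
    (hne : k = 0 → 2 * r < Fintype.card α) {s : Finset α} {a b : α}
    (ha : a ∉ s) (hb : b ∉ s) (hab : a ≠ b) (hs : s.card + 1 = r) :
    ∃ f : Finset α, f.card = r ∧ (insert a s ∩ f).card = k ∧ (insert b s ∩ f).card = k := by
  set t : Finset α := (insert a (insert b s))ᶜ with ht
  have hat : a ∉ t := by simp [ht]
  have hbt : b ∉ t := by simp [ht]
  have hst : ∀ x ∈ t, x ∉ s := fun x hx hxs => by simp [ht, hxs] at hx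
  have htc : t.card = Fintype.card α - (r + 1) := by
    rw [ht, Finset.card_compl, Finset.card_insert_of_notMem (by simp [hab, ha]),
      Finset.card_insert_of_notMem hb, hs]
  rcases Nat.eq_zero_or_pos k with rfl | hk0
  · obtain ⟨f, hft, hf⟩ := Finset.exists_subset_card_eq (s := t) (n := r)
      (by have := hne rfl; omega)
    have (c : α) (hc : c ∉ t) : (insert c s ∩ f).card = 0 := by
      rw [Finset.card_eq_zero, ← Finset.disjoint_iff_inter_eq_empty, Finset.disjoint_right]
      intro x hx
      have := hst x (hft hx)
      have : x ≠ c := fun h => hc (h ▸ hft hx)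
      simp [*]
    exact ⟨f, hf, this a hat, this b hbt⟩
  · obtain ⟨p, hps, hp⟩ := Finset.exists_subset_card_eq (s := s) (n := k - 1) (by omega)
    obtain ⟨q, hqt, hq⟩ := Finset.exists_subset_card_eq (s := t) (n := r - k - 1) (by omega)
    have hpq : Disjoint p q := Finset.disjoint_right.2 fun x hx hxp => hst x (hqt hx) (hps hxp)
    have inter (c d : α) (hc : c ∉ s) (hcd : c ≠ d) (hd : d ∉ s) :
        (insert c s ∩ insert c (insert d (p ∪ q))).card = k := by
      have : insert c s ∩ insert c (insert d (p ∪ q)) = insert c p := by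
        ext x
        have h1 := @hps x
        have h2 : x ∈ q → x ∉ s := fun hx => hst x (hqt hx)
        simp only [Finset.mem_inter, Finset.mem_insert, Finset.mem_union]
        grind
      rw [this, Finset.card_insert_of_notMem fun h => hc (hps h)]
      omega
    refine ⟨insert a (insert b (p ∪ q)), ?_, inter a b ha hab hb, ?_⟩
    · have h1 : b ∉ p ∪ q := by
        simpa using ⟨fun h => hb (hps h), fun h => hbt (hqt h)⟩
      have h2 : a ∉ insert b (p ∪ q) := by
        simpa [hab] using ⟨fun h => ha (hps h), fun h => hat (hqt h)⟩
      rw [Finset.card_insert_of_notMem h2, Finset.card_insert_of_notMem h1,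
        Finset.card_union_of_disjoint hpq]
      omega
    · rw [Finset.insert_comm]
      exact inter b a hb hab.symm ha

theorem Set.powersetCard.interGraph_preconnected {α : Type*} [DecidableEq α] [Fintype α]
    {r k : ℕ} (hk : k < r) (hn : 2 * r - k ≤ Fintype.card α)
    (hne : k = 0 → 2 * r < Fintype.card α) :
    (Set.powersetCard.interGraph α r k).Preconnected := by
  intro e f
  induction h : (e.1 \ f.1).card generalizing e with
  | zero =>
    have hsub : e.1 ⊆ f.1 := Finset.sdiff_eq_empty_iff_subset.1 (Finset.card_eq_zero.1 h)
    rw [Set.powersetCard.eq_iff_subset.2 hsub]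
  | succ m ih =>
    obtain ⟨a, ha⟩ := Finset.card_pos.1 (m.succ_pos.trans_eq h.symm)
    have hcard : (f.1 \ e.1).card = (e.1 \ f.1).card :=
      (Finset.card_sdiff_comm (e.2.trans f.2.symm)).symm
    obtain ⟨b, hb⟩ := Finset.card_pos.1 (m.succ_pos.trans_eq (hcard.trans h).symm)
    rw [Finset.mem_sdiff] at ha hb
    set s := e.1.erase a with hs
    have has : a ∉ s := Finset.notMem_erase a _
    have hbs : b ∉ s := fun h => hb.2 (Finset.mem_of_mem_erase h)
    have hab : a ≠ b := fun h => hb.2 (h ▸ ha.1)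
    have hsc : s.card + 1 = r := (Finset.card_erase_add_one ha.1).trans e.2
    have hes : insert a s = e.1 := Finset.insert_erase ha.1
    obtain ⟨g, hg, hag, hbg⟩ :=
      Set.powersetCard.exists_card_insert_inter_eq hk hn hne has hbs hab hsc
    let e' : Set.powersetCard α r := ⟨insert b s, (Finset.card_insert_of_notMem hbs).trans hsc⟩
    let g' : Set.powersetCard α r := ⟨g, hg⟩
    have adj (c : Set.powersetCard α r) (hc : (c.1 ∩ g).card = k) :
        (Set.powersetCard.interGraph α r k).Adj c g' := by
      refine ⟨?_, hc⟩
      rintro rfl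
      rw [Finset.inter_self, hg] at hc
      omega
    have hm : (e'.1 \ f.1).card = m := by
      have : e'.1 \ f.1 = (e.1 \ f.1).erase a := by
        ext x
        simp only [e', hs, Finset.mem_sdiff, Finset.mem_insert, Finset.mem_erase]
        grind
      rw [this, Finset.card_erase_of_mem (Finset.mem_sdiff.2 ha), h, Nat.add_sub_cancel]
    exact ((adj e (hes ▸ hag)).reachable.trans (adj e' hbg).symm.reachable).trans (ih e' hm)

theorem Set.powersetCard.exists_isMatchingInvolution_interGraph {α : Type*} [DecidableEq α]
    [Fintype α] {r k : ℕ} (hk : k < r) (hn : 2 * r - k ≤ Fintype.card α) :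
    ∃ f, (Set.powersetCard.interGraph α r k).IsMatchingInvolution f ∧
      (Function.fixedPoints f).Subsingleton := by
  by_cases h : k = 0 ∧ Fintype.card α ≤ 2 * r
  · obtain ⟨rfl, hle⟩ := h
    have hr : Fintype.card α - r = r := by omega
    let f (e : Set.powersetCard α r) : Set.powersetCard α r :=
      ⟨e.1ᶜ, by rw [Set.powersetCard.mem_iff, Finset.card_compl, e.2, hr]⟩
    have hf (e : Set.powersetCard α r) : f e ≠ e := by
      intro he
      have h1 : e.1ᶜ = e.1 := congrArg Subtype.val he
      have h2 : e.1 = ∅ := by simpa [h1] using Finset.inter_compl e.1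
      have h3 := e.2
      rw [Set.powersetCard.mem_iff, h2, Finset.card_empty] at h3
      omega
    exact ⟨f, ⟨fun e => Subtype.ext (compl_compl e.1), fun e _ => ⟨(hf e).symm, by simp [f]⟩⟩,
      fun e he => (hf e he).elim⟩
  · exact SimpleGraph.exists_isMatchingInvolution_subsingleton _
      (Set.powersetCard.interGraph_preconnected hk hn fun h0 => by omega)
      (Set.powersetCard.interGraph_exists_iso α r k)

/-- If `0 ≤ k ≤ r - 1` and `n ≥ 2r - k`, then the collection of all `r`-element subsets of
an `n`-element set can be partitioned into `⌊C(n,r)/2⌋` pairs of `r`-subsets, each pair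
intersecting in exactly `k` elements, together with one leftover `r`-subset when `C(n,r)`
is odd (i.e. `C(n,r) % 2` singleton parts). -/
theorem partition_into_pairs (r k n : ℕ) (hk : k + 1 ≤ r) (hn : 2 * r - k ≤ n) :
    ∃ P : Finset (Finset (Finset (Fin n))),
      (∀ p ∈ P, ∀ q ∈ P, p ≠ q → Disjoint p q) ∧
      P.biUnion id = Finset.powersetCard r (Finset.univ : Finset (Fin n)) ∧
      (∀ p ∈ P, (∃ e f : Finset (Fin n), e ≠ f ∧ (e ∩ f).card = k ∧ p = {e, f}) ∨
        (∃ e, p = {e})) ∧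
      (P.filter (fun p => p.card = 2)).card = n.choose r / 2 ∧
      (P.filter (fun p => p.card = 1)).card = n.choose r % 2 := by
  obtain ⟨f, ⟨hinv, hadj⟩, hfix⟩ := Set.powersetCard.exists_isMatchingInvolution_interGraph
    (α := Fin n) hk (by simpa using hn)
  let c (v : Set.powersetCard (Fin n) r) : Finset (Finset (Fin n)) := {v.1, (f v).1}
  have hcf (v : Set.powersetCard (Fin n) r) : c (f v) = c v := by
    simp [c, hinv v, Finset.pair_comm]
  have hmem (v : Set.powersetCard (Fin n) r) (e : Finset (Fin n)) (he : e ∈ c v) :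
      ∃ w : Set.powersetCard (Fin n) r, w.1 = e ∧ c w = c v := by
    rcases Finset.mem_insert.1 he with rfl | he
    · exact ⟨v, rfl, rfl⟩
    · exact ⟨f v, (Finset.mem_singleton.1 he).symm, hcf v⟩
  have hcard (v : Set.powersetCard (Fin n) r) :
      (f v = v ∧ (c v).card = 1) ∨ (f v ≠ v ∧ (c v).card = 2) := by
    by_cases h : f v = v
    · exact Or.inl ⟨h, by simp [c, h]⟩
    · exact Or.inr ⟨h, Finset.card_pair fun e => h (Subtype.ext e.symm)⟩
  let P := Finset.univ.image c
  have hdisj : ∀ p ∈ P, ∀ q ∈ P, p ≠ q → Disjoint p q := by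
    simp only [P, Finset.mem_image, Finset.mem_univ, true_and]
    rintro _ ⟨v, rfl⟩ _ ⟨w, rfl⟩ hne
    refine Finset.disjoint_left.2 fun e hev hew => hne ?_
    obtain ⟨x, rfl, hx⟩ := hmem v e hev
    obtain ⟨y, hy, hyw⟩ := hmem w _ hew
    rw [← hx, ← hyw, Subtype.ext hy]
  have hunion : P.biUnion id = Finset.powersetCard r (Finset.univ : Finset (Fin n)) := by
    ext e
    simp only [P, Finset.mem_biUnion, Finset.mem_image, Finset.mem_univ, true_and, id,
      Finset.mem_powersetCard_univ]
    constructor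
    · rintro ⟨_, ⟨v, rfl⟩, he⟩
      obtain ⟨w, rfl, -⟩ := hmem v e he
      exact w.2
    · exact fun he => ⟨_, ⟨⟨e, he⟩, rfl⟩, by simp [c]⟩
  have hone : (P.filter (fun p => p.card = 1)).card ≤ 1 := by
    refine Finset.card_le_one.2 ?_
    simp only [P, Finset.mem_filter, Finset.mem_image, Finset.mem_univ, true_and]
    rintro _ ⟨⟨v, rfl⟩, hv⟩ _ ⟨⟨w, rfl⟩, hw⟩
    have hfv : f v = v := ((hcard v).resolve_right fun h => by omega).1
    have hfw : f w = w := ((hcard w).resolve_right fun h => by omega).1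
    rw [hfix hfv hfw]
  have hsum : n.choose r =
      2 * (P.filter (fun p => p.card = 2)).card + (P.filter (fun p => p.card = 1)).card := by
    have h1 := congrArg Finset.card hunion
    rw [Finset.card_biUnion (t := id) hdisj, Finset.card_powersetCard, Finset.card_univ,
      Fintype.card_fin] at h1
    rw [← h1, Finset.card_filter, Finset.card_filter, Finset.mul_sum, ← Finset.sum_add_distrib]
    refine Finset.sum_congr rfl fun p hp => ?_
    obtain ⟨v, -, rfl⟩ := Finset.mem_image.1 hp
    rcases hcard v with h | h <;> simp [h.2]
  refine ⟨P, hdisj, hunion, fun p hp => ?_, by omega, by omega⟩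
  obtain ⟨v, -, rfl⟩ := Finset.mem_image.1 hp
  by_cases h : f v = v
  · exact Or.inr ⟨v.1, by simp [c, h]⟩
  · exact Or.inl ⟨v.1, (f v).1, fun e => h (Subtype.ext e.symm), (hadj v h).2, rfl⟩
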